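/- Let A be a separable unital C*-algebra with compact generating set K that is compact (Σ(A) is a compact subset of (Rep(A), d_K)). Then A has the strong Ascoli property: every set L ⊆ A that is bounded in norm and equicontinuous with respect to Σ(A) (for every ε > 0 there exists δ > 0 such that for all π, π' ∈ Σ(A) with d_K(π,π') < δ and all x ∈ L, ‖π(x) − π'(x)‖ < ε) is relatively compact in the norm topology of A. -/

import Mathlib

noncomputable section

abbrev H2 : Type := lp (fun _ : ℕ => ℂ) 2
abbrev BH : Type := H2 →L[ℂ] H2

abbrev RepSp (A : Type*) [CStarAlgebra A] := A →⋆ₐ[ℂ] BH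

def Generates {A : Type*} [CStarAlgebra A] (K : Set A) : Prop :=
  (StarAlgebra.adjoin ℂ K).topologicalClosure = ⊤

def dRep {A : Type*} [CStarAlgebra A] (K : Set A) (π₁ π₂ : RepSp A) : ℝ :=
  ⨆ a ∈ K, ‖π₁ a - π₂ a‖

abbrev lpE (n : ℕ) : Type := lp (fun _ : ℕ => EuclideanSpace ℂ (Fin n)) 2

/-- A representation is irreducible if its commutant is trivial. -/
def IsIrredRep {A : Type*} [CStarAlgebra A] (π : RepSp A) : Prop :=
  ∀ T : BH, (∀ a : A, T * π a = π a * T) → ∃ c : ℂ, T = c • (1 : BH)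

/-- `Σ⁰(A)`: irreducible representations on `ℓ²`, together with the countable
amplifications `ℵ₀ ⊙ ρ` of finite-dimensional irreducible representations `ρ`. -/
def Sigma0 (A : Type*) [CStarAlgebra A] : Set (RepSp A) :=
  {π | IsIrredRep π ∨
    ∃ n : ℕ, 0 < n ∧ ∃ ρ : A →⋆ₐ[ℂ] Matrix (Fin n) (Fin n) ℂ,
      (∀ T : Matrix (Fin n) (Fin n) ℂ, (∀ a : A, T * ρ a = ρ a * T) →
        ∃ c : ℂ, T = c • (1 : Matrix (Fin n) (Fin n) ℂ)) ∧
      ∃ u : H2 ≃ₗᵢ[ℂ] lpE n, ∀ (a : A) (f : lpE n) (k : ℕ),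
        u (π a (u.symm f)) k = Matrix.toEuclideanLin (ρ a) (f k)}

/-- `Σ(A)`: the closure of `Σ⁰(A)` with respect to the metric `d_K`. -/
def SigmaSet {A : Type*} [CStarAlgebra A] (K : Set A) : Set (RepSp A) :=
  {π | ∀ ε > (0 : ℝ), ∃ π' ∈ Sigma0 A, dRep K π π' < ε}

/-- Sequential compactness of a set of representations with respect to `d_K`;
for the metric space `(Rep(A), d_K)` this is equivalent to compactness. -/
def RepSeqCompact {A : Type*} [CStarAlgebra A] (K : Set A) (S : Set (RepSp A)) : Prop :=
  ∀ u : ℕ → RepSp A, (∀ n, u n ∈ S) →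
    ∃ π ∈ S, ∃ φ : ℕ → ℕ, StrictMono φ ∧
      Filter.Tendsto (fun n => dRep K (u (φ n)) π) Filter.atTop (nhds 0)

section Helpers

open scoped ComplexOrder InnerProductSpace

/-- A norming functional for `x` which is an extreme point of the unit ball of the dual. -/
theorem exists_extreme_norming {E : Type*} [NormedAddCommGroup E] [NormedSpace ℂ E] (x : E) :
    ∃ f : E →L[ℂ] ℂ, (∀ a, ‖f a‖ ≤ ‖a‖) ∧ f x = ‖x‖ ∧
      ∀ g k : E →L[ℂ] ℂ, (∀ a, ‖g a‖ ≤ ‖a‖) → (∀ a, ‖k a‖ ≤ ‖a‖) →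
        ∀ s t : ℝ, 0 < s → 0 < t → s + t = 1 → s • g + t • k = f → g = f := by
  let S : Set (WeakDual ℂ E) :=
    (WeakDual.toStrongDual ⁻¹' Metric.closedBall 0 1) ∩ {g | g x = (‖x‖ : ℂ)}
  have memS (g : E →L[ℂ] ℂ) : StrongDual.toWeakDual g ∈ S ↔
      (∀ a, ‖g a‖ ≤ ‖a‖) ∧ g x = (‖x‖ : ℂ) := by
    refine and_congr ?_ Iff.rfl
    rw [Set.mem_preimage, mem_closedBall_zero_iff]
    change ‖g‖ ≤ 1 ↔ _
    constructor
    · intro h a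
      simpa using g.le_of_opNorm_le h a
    · intro h
      exact g.opNorm_le_bound zero_le_one (by simpa using h)
  have hcomp : IsCompact S := by
    refine (WeakDual.isCompact_closedBall (0 : StrongDual ℂ E) 1).inter_right ?_
    exact isClosed_eq (WeakDual.eval_continuous x) continuous_const
  have hne : S.Nonempty := by
    obtain ⟨g, hg, hgx⟩ := exists_dual_vector'' ℂ x
    refine ⟨StrongDual.toWeakDual g, (memS g).2 ⟨fun a => ?_, hgx⟩⟩
    simpa using g.le_of_opNorm_le hg a
  have : LocallyConvexSpace ℝ (WeakDual ℂ E) := by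
    let F : WeakDual ℂ E →ₗ[ℝ] (E → ℂ) :=
      { toFun := fun g a => g a, map_add' := fun _ _ => rfl, map_smul' := fun _ _ => rfl }
    exact LocallyConvexSpace.induced F
  obtain ⟨f, hf⟩ := hcomp.extremePoints_nonempty hne
  have hfS := (memS (WeakDual.toStrongDual f)).1 hf.1
  refine ⟨WeakDual.toStrongDual f, hfS.1, hfS.2, fun g k hg hk s t hs ht hst hgk => ?_⟩
  have hval : s • g x + t • k x = (‖x‖ : ℂ) := by
    rw [← hfS.2, ← hgk]; rfl
  have hre : s * (g x).re + t * (k x).re = ‖x‖ := by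
    simpa using congrArg Complex.re hval
  have h1 : (g x).re ≤ ‖x‖ := (Complex.re_le_norm _).trans (hg x)
  have h2 : (k x).re ≤ ‖x‖ := (Complex.re_le_norm _).trans (hk x)
  have norming (z : ℂ) (hz : ‖z‖ ≤ ‖x‖) (hz' : z.re = ‖x‖) : z = ‖x‖ := by
    apply Complex.ext
    · simpa using hz'
    · have := Complex.sq_norm z
      rw [Complex.normSq_apply] at this
      have h3 : z.im * z.im ≤ 0 := by nlinarith [norm_nonneg z]
      simpa using le_antisymm h3 (mul_self_nonneg _)
  have hsx : s * ‖x‖ + t * ‖x‖ = ‖x‖ := by rw [← add_mul, hst, one_mul]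
  have g1 : (g x).re = ‖x‖ := h1.antisymm <| not_lt.1 fun h => by
    linarith [mul_lt_mul_of_pos_left h hs, mul_le_mul_of_nonneg_left h2 ht.le]
  have k1 : (k x).re = ‖x‖ := h2.antisymm <| not_lt.1 fun h => by
    linarith [mul_lt_mul_of_pos_left h ht, mul_le_mul_of_nonneg_left h1 hs.le]
  have := hf.2 ((memS g).2 ⟨hg, norming _ (hg x) g1⟩) ((memS k).2 ⟨hk, norming _ (hk x) k1⟩)
    ⟨s, t, hs, ht, hst, hgk⟩
  exact this

/-- A norm-one functional with `f 1 = 1` is nonnegative on nonnegative elements. -/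
theorem nonneg_of_contractive {A : Type*} [CStarAlgebra A] [PartialOrder A] [StarOrderedRing A]
    (f : A →L[ℂ] ℂ) (hf : ∀ a, ‖f a‖ ≤ ‖a‖) (h1 : f 1 = 1) (a : A) (ha : 0 ≤ a) :
    0 ≤ f a := by
  have hsa : IsSelfAdjoint a := .of_nonneg ha
  rw [Complex.nonneg_iff]
  constructor
  · have h : ‖algebraMap ℝ A ‖a‖ - a‖ ≤ ‖a‖ := by
      refine (CStarAlgebra.norm_le_iff_le_algebraMap _ (norm_nonneg a) ?_).2 ?_
      · exact sub_nonneg.2 hsa.le_algebraMap_norm_self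
      · simpa using ha
    have h2 := (Complex.re_le_norm _).trans ((hf _).trans h)
    rw [map_sub, Algebra.algebraMap_eq_smul_one] at h2
    have h3 : f (‖a‖ • (1 : A)) = (‖a‖ : ℂ) := by
      rw [← Complex.coe_smul, map_smul, h1]; simp
    rw [h3] at h2
    simp at h2
    exact h2
  · by_contra him
    have key (t : ℝ) : ((f a).im + t) ^ 2 ≤ ‖a‖ ^ 2 + t ^ 2 := by
      have e1 : ‖a + (Complex.I * t) • (1 : A)‖ ^ 2 ≤ ‖a‖ ^ 2 + t ^ 2 := by
        rw [sq, ← CStarRing.norm_star_mul_self]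
        have : star (a + (Complex.I * t) • (1 : A)) * (a + (Complex.I * t) • (1 : A))
            = a * a + ((t : ℂ) ^ 2) • (1 : A) := by
          simp only [star_add, star_smul, hsa.star_eq, star_one, add_mul, mul_add, mul_one, one_mul,
            smul_mul_assoc, mul_smul_comm]
          simp only [star_mul', Complex.star_def, Complex.conj_I, Complex.conj_ofReal]
          have h4 : Complex.I * (t : ℂ) * (-Complex.I * t) = (t : ℂ) ^ 2 := by
            linear_combination (-(t : ℂ) ^ 2) * Complex.I_sq
          rw [smul_add, smul_smul, h4]
          module
        rw [this]
        refine (norm_add_le _ _).trans ?_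
        gcongr
        · rw [sq]; exact norm_mul_le _ _
        · rw [norm_smul]
          have : Nontrivial A := by
            refine nontrivial_of_ne (1 : A) 0 fun h => ?_
            simp [h] at h1
          simp
      have e2 : |(f a).im + t| ≤ ‖a + (Complex.I * t) • (1 : A)‖ := by
        refine le_trans ?_ (hf _)
        rw [map_add, map_smul, h1]
        simpa using Complex.abs_im_le_norm (f a + (Complex.I * t) • (1 : ℂ))
      calc _ = |(f a).im + t| ^ 2 := (sq_abs _).symm
        _ ≤ _ := by gcongr
        _ ≤ _ := e1
    have him' : (f a).im ≠ 0 := fun h => him h.symm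
    have := key (‖a‖ ^ 2 / (f a).im)
    have e3 : (f a).im * (‖a‖ ^ 2 / (f a).im) = ‖a‖ ^ 2 := by field_simp
    nlinarith [sq_nonneg ‖a‖, sq_pos_of_ne_zero him']

/-- If the vector functional of a cyclic unit vector is an extreme point of the unit ball of the
dual, then the representation has trivial commutant. -/
theorem commutant_trivial_of_extreme {A H : Type*} [CStarAlgebra A] [NormedAddCommGroup H]
    [InnerProductSpace ℂ H] [CompleteSpace H] (π : A →⋆ₐ[ℂ] (H →L[ℂ] H)) (ξ : H) (hξ : ‖ξ‖ = 1)
    (hcyc : DenseRange fun a => π a ξ) (f : A →L[ℂ] ℂ) (hf : ∀ a, ⟪ξ, π a ξ⟫_ℂ = f a)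
    (hext : ∀ g k : A →L[ℂ] ℂ, (∀ a, ‖g a‖ ≤ ‖a‖) → (∀ a, ‖k a‖ ≤ ‖a‖) →
      ∀ s t : ℝ, 0 < s → 0 < t → s + t = 1 → s • g + t • k = f → g = f)
    (T : H →L[ℂ] H) (hT : ∀ a, T * π a = π a * T) : ∃ c : ℂ, T = c • (1 : H →L[ℂ] H) := by
  have hbd (a : A) : ‖π a‖ ≤ ‖a‖ := NonUnitalStarAlgHom.norm_apply_le π a
  let vf (v : H) : A →L[ℂ] ℂ := LinearMap.mkContinuous
    { toFun := fun a => ⟪v, π a v⟫_ℂ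
      map_add' := fun a b => by simp
      map_smul' := fun c a => by simp } (‖v‖ ^ 2) (fun a => by
        refine (norm_inner_le_norm v (π a v)).trans ?_
        have := (π a).le_of_opNorm_le (hbd a) v
        nlinarith [norm_nonneg v])
  have vf_apply (v : H) (a : A) : vf v a = ⟪v, π a v⟫_ℂ := rfl
  have vf_le (v : H) (a : A) : ‖vf v a‖ ≤ ‖v‖ ^ 2 * ‖a‖ :=
    by
      rw [vf_apply]
      refine (norm_inner_le_norm _ _).trans ?_
      have := (π a).le_of_opNorm_le (hbd a) v
      nlinarith [norm_nonneg v]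
  have scal (S : H →L[ℂ] H) (hS : ∀ a, S * π a = π a * S)
      (h : ∀ a, ⟪S ξ, π a ξ⟫_ℂ = 0) : S = 0 := by
    have h1 : S ξ = 0 := hcyc.eq_zero_of_inner_left ℂ h
    ext v
    refine congrFun (hcyc.equalizer S.continuous (0 : H →L[ℂ] H).continuous ?_) v
    funext a
    have := DFunLike.congr_fun (hS a) ξ
    simpa [h1] using this
  -- real parts of unitaries in the commutant
  have real_part (U : H →L[ℂ] H) (hU : U ∈ unitary (H →L[ℂ] H)) (hUc : ∀ a, U * π a = π a * U) :
      ∃ c : ℂ, U + star U = c • (1 : H →L[ℂ] H) := by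
    have hUs (a : A) : star U * π a = π a * star U := by
      have := congrArg star (hUc (star a))
      simpa [map_star] using this.symm
    rw [Unitary.mem_iff] at hU
    set V : H →L[ℂ] H := (1 / 2 : ℂ) • (1 + U) with hV
    set W : H →L[ℂ] H := (1 / 2 : ℂ) • (1 - U) with hW
    have hVV : star V * V = (1 / 4 : ℂ) • ((2 : ℂ) • 1 + (U + star U)) := by
      simp only [hV, star_smul, star_add, star_one, smul_mul_smul_comm, add_mul, mul_add, one_mul,
        mul_one, hU.1]
      norm_num
      module
    have hWW : star W * W = (1 / 4 : ℂ) • ((2 : ℂ) • 1 - (U + star U)) := by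
      simp only [hW, star_smul, star_sub, star_one, smul_mul_smul_comm, sub_mul, mul_sub, one_mul,
        mul_one, hU.1]
      norm_num
      module
    have hsum : star V * V + star W * W = 1 := by rw [hVV, hWW]; module
    have hVc (a : A) : V * π a = π a * V := by simp [hV, add_mul, mul_add, hUc]
    have hWc (a : A) : W * π a = π a * W := by simp [hW, sub_mul, mul_sub, hUc]
    clear_value V W
    have move (X : H →L[ℂ] H) (hX : ∀ a, X * π a = π a * X) (a : A) :
        vf (X ξ) a = ⟪(star X * X) ξ, π a ξ⟫_ℂ := by
      have := DFunLike.congr_fun (hX a) ξ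
      simp only [mul_apply_eq_comp] at this ⊢
      rw [vf_apply, ← this, ContinuousLinearMap.star_eq_adjoint,
        ContinuousLinearMap.adjoint_inner_left]
    have hvw : vf (V ξ) + vf (W ξ) = f := by
      ext a
      rw [add_apply, move V hVc, move W hWc, ← inner_add_left,
        ← add_apply, hsum, ← hf]
      rfl
    have hnorm : ‖V ξ‖ ^ 2 + ‖W ξ‖ ^ 2 = 1 := by
      have h1 := DFunLike.congr_fun hvw 1
      have h2 : f 1 = 1 := by rw [← hf, map_one]; simp [hξ]
      rw [add_apply, h2, vf_apply, vf_apply, map_one] at h1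
      simp only [one_apply_eq_self, inner_self_eq_norm_sq_to_K] at h1
      exact Complex.ofReal_injective (by push_cast; exact h1)
    have hprop : ∀ a, vf (V ξ) a = (‖V ξ‖ ^ 2 : ℝ) * f a := by
      intro a
      by_cases hv0 : V ξ = 0
      · simp [vf_apply, hv0]
      by_cases hw0 : W ξ = 0
      · have h3 : ‖V ξ‖ ^ 2 = 1 := by simpa [hw0] using hnorm
        rw [h3, ← hvw]
        simp [vf_apply, hw0]
      have hs : 0 < ‖V ξ‖ ^ 2 := by positivity
      have ht : 0 < ‖W ξ‖ ^ 2 := by positivity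
      have key (v : H) (hv : 0 < ‖v‖ ^ 2) (a : A) : ‖((‖v‖ ^ 2)⁻¹ • vf v) a‖ ≤ ‖a‖ := by
        rw [smul_apply, norm_smul, Real.norm_of_nonneg (by positivity),
          inv_mul_le_iff₀ hv]
        exact vf_le v a
      have := hext ((‖V ξ‖ ^ 2)⁻¹ • vf (V ξ)) ((‖W ξ‖ ^ 2)⁻¹ • vf (W ξ)) (key _ hs) (key _ ht)
        _ _ hs ht hnorm (by rw [smul_inv_smul₀ hs.ne', smul_inv_smul₀ ht.ne', hvw])
      rw [← this, smul_apply, Complex.real_smul, ← mul_assoc,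
        ← Complex.ofReal_mul, mul_inv_cancel₀ hs.ne']
      simp
    have hzero : star V * V - ((‖V ξ‖ ^ 2 : ℝ) : ℂ) • (1 : H →L[ℂ] H) = 0 := by
      refine scal _ (fun a => ?_) (fun a => ?_)
      · rw [hVV]
        simp [sub_mul, mul_sub, add_mul, mul_add, hUc, hUs]
      · rw [sub_apply, inner_sub_left, ← move V hVc, hprop,
          smul_apply, inner_smul_left, Complex.conj_ofReal,
          one_apply_eq_self, hf, sub_self]
    refine ⟨4 * ((‖V ξ‖ ^ 2 : ℝ) : ℂ) - 2, ?_⟩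
    rw [sub_eq_zero, hVV] at hzero
    rw [sub_smul, mul_smul, ← hzero]
    module
  have unit_scal (U : H →L[ℂ] H) (hU : U ∈ unitary (H →L[ℂ] H)) (hUc : ∀ a, U * π a = π a * U) :
      ∃ c : ℂ, U = c • (1 : H →L[ℂ] H) := by
    obtain ⟨c, hc⟩ := real_part U hU hUc
    obtain ⟨d, hd⟩ := real_part (Complex.I • U)
      (by
        rw [Unitary.mem_iff] at hU ⊢
        simp [smul_smul, hU.1, hU.2]) (fun a => by simp [hUc])
    refine ⟨(c - Complex.I * d) / 2, ?_⟩
    have hd' : U - star U = (-Complex.I * d) • (1 : H →L[ℂ] H) := by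
      rw [mul_smul, ← hd, smul_add]
      simp [smul_smul, sub_eq_add_neg]
    have : (2 : ℂ) • U = (c - Complex.I * d) • (1 : H →L[ℂ] H) := by
      calc (2 : ℂ) • U = (U + star U) + (U - star U) := by module
        _ = _ := by rw [hc, hd']; module
    rw [div_eq_inv_mul, mul_smul, ← this, smul_smul]; simp
  let C : StarSubalgebra ℂ (H →L[ℂ] H) := StarSubalgebra.centralizer ℂ (Set.range π)
  have hC (S : H →L[ℂ] H) : S ∈ C ↔ ∀ a, S * π a = π a * S := by
    rw [StarSubalgebra.mem_centralizer_iff]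
    constructor
    · intro h a; exact (h _ ⟨a, rfl⟩).1.symm
    · rintro h _ ⟨a, rfl⟩
      exact ⟨(h a).symm, by rw [← map_star, h]⟩
  have hclosed : IsClosed (C : Set (H →L[ℂ] H)) := by
    have : (C : Set (H →L[ℂ] H)) = ⋂ a, {S | S * π a = π a * S} := by
      ext S; simp [hC]
    rw [this]
    exact isClosed_iInter fun a => isClosed_eq (by fun_prop) (by fun_prop)
  have := hclosed
  obtain ⟨u, c, hu, -⟩ := CStarAlgebra.exists_sum_four_unitary (⟨T, (hC T).2 hT⟩ : C)
  have hui (i : Fin 4) : ∃ d : ℂ, ((u i : C) : H →L[ℂ] H) = d • (1 : H →L[ℂ] H) := by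
    refine unit_scal _ ?_ ((hC _).1 (u i : C).2)
    have := Unitary.mem_iff.1 (u i).2
    exact Unitary.mem_iff.2 ⟨congrArg Subtype.val this.1, congrArg Subtype.val this.2⟩
  choose d hd using hui
  refine ⟨∑ i, c i * d i, ?_⟩
  have := congrArg Subtype.val hu
  simp only [AddSubmonoidClass.coe_finsetSum, SetLike.val_smul, hd] at this
  rw [this, Finset.sum_smul]
  simp [smul_smul]

/-- A contractive functional attaining its norm at `‖h‖ + h`, with `h` nonnegative and nonzero, is
a state with `f h = ‖h‖`. -/
theorem state_of_norming {A : Type*} [CStarAlgebra A] [PartialOrder A] [StarOrderedRing A]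
    {h : A} (hh : 0 ≤ h) (h0 : h ≠ 0) (f : A →L[ℂ] ℂ) (hf : ∀ a, ‖f a‖ ≤ ‖a‖)
    (hfx : f (algebraMap ℝ A ‖h‖ + h) = ‖algebraMap ℝ A ‖h‖ + h‖) :
    f 1 = 1 ∧ f h = ‖h‖ := by
  have : Nontrivial A := nontrivial_of_ne h 0 h0
  have hpos : 0 < ‖h‖ := norm_pos_iff.2 h0
  have hnorm : 2 * ‖h‖ ≤ ‖algebraMap ℝ A ‖h‖ + h‖ := by
    have h1 : ‖h‖ + ‖h‖ ∈ spectrum ℝ (algebraMap ℝ A ‖h‖ + h) :=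
      spectrum.add_mem_add_iff.2 (CStarAlgebra.norm_mem_spectrum_of_nonneg hh)
    have h2 := spectrum.norm_le_norm_of_mem h1
    rw [Real.norm_of_nonneg (by positivity)] at h2
    linarith
  have hmap : f (algebraMap ℝ A ‖h‖) = ‖h‖ * f 1 := by
    rw [Algebra.algebraMap_eq_smul_one, ← Complex.coe_smul, map_smul, smul_eq_mul]
  have b1 : ‖f 1‖ ≤ 1 := by simpa using hf 1
  have b2 := hf h
  have hre : ‖h‖ * (f 1).re + (f h).re = ‖algebraMap ℝ A ‖h‖ + h‖ := by
    have := congrArg Complex.re hfx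
    rw [map_add, hmap] at this
    simpa using this
  have c1 := (Complex.re_le_norm _).trans b1
  have c2 := (Complex.re_le_norm _).trans b2
  have eq_of_re (z : ℂ) (r : ℝ) (hz : ‖z‖ ≤ r) (hz' : z.re = r) : z = r := by
    apply Complex.ext
    · simpa using hz'
    · have := Complex.sq_norm z
      rw [Complex.normSq_apply] at this
      have h3 : z.im * z.im ≤ 0 := by nlinarith [norm_nonneg z]
      simpa using le_antisymm h3 (mul_self_nonneg _)
  constructor
  · simpa using eq_of_re _ 1 b1 (c1.antisymm (by nlinarith))
  · exact eq_of_re _ _ b2 (c2.antisymm (by nlinarith))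

/-- Every nonzero element of a C⋆-algebra is nonzero in some cyclic representation with trivial
commutant. -/
theorem exists_irreducible_cyclic.{u} {A : Type u} [CStarAlgebra A] {b : A} (hb : b ≠ 0) :
    ∃ (H : Type u) (_ : NormedAddCommGroup H) (_ : InnerProductSpace ℂ H) (_ : CompleteSpace H)
      (π : A →⋆ₐ[ℂ] (H →L[ℂ] H)) (ξ : H), π b ≠ 0 ∧ (DenseRange fun a => π a ξ) ∧
      ∀ T : H →L[ℂ] H, (∀ a, T * π a = π a * T) → ∃ c : ℂ, T = c • (1 : H →L[ℂ] H) := by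
  let _ := CStarAlgebra.spectralOrder A
  let _ := CStarAlgebra.spectralOrderedRing A
  have hh : 0 ≤ star b * b := star_mul_self_nonneg b
  have h0 : star b * b ≠ 0 := by simpa using hb
  obtain ⟨f, hf, hfx, hext⟩ := exists_extreme_norming (algebraMap ℝ A ‖star b * b‖ + star b * b)
  obtain ⟨f1, fh⟩ := state_of_norming hh h0 f hf hfx
  let p : A →ₚ[ℂ] ℂ := PositiveLinearMap.mk₀ (f : A →ₗ[ℂ] ℂ) (nonneg_of_contractive f hf f1)
  have hp (a : A) : p a = f a := rfl
  let ξ : p.GNS := (p.toPreGNS 1 : p.PreGNS)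
  have hπ (a : A) : p.gnsStarAlgHom a ξ = (p.toPreGNS a : p.PreGNS) := by
    change p.gnsNonUnitalStarAlgHom a _ = _
    rw [PositiveLinearMap.gnsNonUnitalStarAlgHom_apply_coe]
    simp
  have hinner (a c : A) : ⟪p.gnsStarAlgHom a ξ, p.gnsStarAlgHom c ξ⟫_ℂ = f (star a * c) := by
    rw [hπ, hπ, UniformSpace.Completion.inner_coe, PositiveLinearMap.preGNS_inner_def]
    simp [hp]
  have hf' (a : A) : ⟪ξ, p.gnsStarAlgHom a ξ⟫_ℂ = f a := by
    simpa using hinner 1 a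
  have hξ : ‖ξ‖ = 1 := by
    have := inner_self_eq_norm_sq_to_K (𝕜 := ℂ) ξ
    rw [show ⟪ξ, ξ⟫_ℂ = 1 by simpa [f1] using hf' 1] at this
    have h2 : ‖ξ‖ ^ 2 = 1 := Complex.ofReal_injective (by push_cast; exact this.symm)
    exact (pow_eq_one_iff_of_nonneg (norm_nonneg ξ) two_ne_zero).1 h2
  have hcyc : DenseRange fun a => p.gnsStarAlgHom a ξ := by
    have : (fun a => p.gnsStarAlgHom a ξ) =
        (fun v : p.PreGNS => (v : p.GNS)) ∘ p.toPreGNS := funext hπ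
    rw [this]
    exact UniformSpace.Completion.denseRange_coe.comp p.toPreGNS.surjective.denseRange
      (UniformSpace.Completion.continuous_coe _)
  refine ⟨p.GNS, inferInstance, inferInstance, inferInstance, p.gnsStarAlgHom, ξ, ?_, hcyc,
    commutant_trivial_of_extreme p.gnsStarAlgHom ξ hξ hcyc f hf' hext⟩
  intro hzero
  have := hinner b b
  rw [hzero, fh] at this
  simp at this
  exact h0 (norm_eq_zero.1 (by exact_mod_cast this.symm))

theorem Orthonormal.one_lt_norm_sub {ι H : Type*} [NormedAddCommGroup H]
    [InnerProductSpace ℂ H] {v : ι → H} (hv : Orthonormal ℂ v) {i j : ι} (hij : i ≠ j) :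
    1 < ‖v i - v j‖ := by
  have h := norm_sub_sq (𝕜 := ℂ) (v i) (v j)
  rw [hv.2 hij, hv.1, hv.1] at h
  norm_num at h
  nlinarith [norm_nonneg (v i - v j)]

theorem Orthonormal.countable_of_separableSpace {ι H : Type*} [NormedAddCommGroup H]
    [InnerProductSpace ℂ H] [TopologicalSpace.SeparableSpace H] {v : ι → H}
    (hv : Orthonormal ℂ v) : Countable ι := by
  rw [← Set.countable_univ_iff]
  refine Set.PairwiseDisjoint.countable_of_isOpen (s := fun i => Metric.ball (v i) (1 / 2)) ?_
    (fun _ _ => Metric.isOpen_ball) (fun i _ => ⟨v i, by simp⟩)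
  intro i _ j _ hij
  refine Metric.ball_disjoint_ball ?_
  rw [dist_eq_norm]
  linarith [hv.one_lt_norm_sub hij]

theorem HilbertBasis.nonempty_linearIsometryEquiv_H2 {ι H : Type*} [NormedAddCommGroup H]
    [InnerProductSpace ℂ H] [CompleteSpace H] (b : HilbertBasis ι ℂ H) [Countable ι]
    [Infinite ι] : Nonempty (H ≃ₗᵢ[ℂ] H2) := by
  obtain ⟨e⟩ : Nonempty (ℕ ≃ ι) := by
    exact nonempty_equiv_of_countable
  refine ⟨(HilbertBasis.mk (b.orthonormal.comp e e.injective) ?_).repr⟩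
  rw [e.surjective.range_comp, b.dense_span]

theorem nonempty_linearIsometryEquiv_lpE {n : ℕ} (hn : 0 < n) :
    Nonempty (lpE n ≃ₗᵢ[ℂ] H2) := by
  classical
  let v : ℕ × Fin n → lpE n := fun p =>
    lp.single 2 p.1 (EuclideanSpace.basisFun (Fin n) ℂ p.2)
  have hin : ∀ p (f : lpE n), ⟪v p, f⟫_ℂ = f p.1 p.2 := by
    intro p f
    rw [lp.inner_single_left, EuclideanSpace.basisFun_apply]
    simp [PiLp.inner_apply]
  have hv : Orthonormal ℂ v := by
    rw [orthonormal_iff_ite]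
    rintro ⟨k, i⟩ ⟨l, j⟩
    rw [hin]
    simp only [v, lp.coeFn_single, EuclideanSpace.basisFun_apply, Prod.mk.injEq]
    by_cases hkl : k = l
    · subst hkl
      simp [PiLp.single_apply]
    · simp [hkl]
  have hbot : (Submodule.span ℂ (Set.range v))ᗮ = ⊥ := by
    rw [eq_bot_iff]
    intro f hf
    rw [Submodule.mem_bot]
    ext k i
    have := (Submodule.mem_orthogonal _ _).1 hf (v (k, i)) (Submodule.subset_span ⟨_, rfl⟩)
    rw [hin] at this
    simpa using this
  have : Nonempty (Fin n) := ⟨⟨0, hn⟩⟩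
  exact (HilbertBasis.mkOfOrthogonalEqBot hv hbot).nonempty_linearIsometryEquiv_H2

/-- The countable amplification of operators on a Hilbert space. -/
def amplify (E : Type*) [NormedAddCommGroup E] [InnerProductSpace ℂ E] [CompleteSpace E] :
    (E →L[ℂ] E) →⋆ₐ[ℂ] (lp (fun _ : ℕ => E) 2 →L[ℂ] lp (fun _ : ℕ => E) 2) where
  toFun T := lp.mapCLM 2 (fun _ => T) (norm_nonneg T) (fun _ => le_rfl)
  map_one' := by ext; rfl
  map_mul' _ _ := by ext; rfl
  map_zero' := by ext; rfl
  map_add' _ _ := by ext; rfl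
  commutes' _ := by ext; rfl
  map_star' T := by
    rw [ContinuousLinearMap.star_eq_adjoint, ContinuousLinearMap.star_eq_adjoint,
      ContinuousLinearMap.eq_adjoint_iff]
    intro f g
    rw [lp.inner_eq_tsum, lp.inner_eq_tsum]
    exact tsum_congr fun k => ContinuousLinearMap.adjoint_inner_left T (g k) (f k)

theorem amplify_apply {E : Type*} [NormedAddCommGroup E] [InnerProductSpace ℂ E]
    [CompleteSpace E] (T : E →L[ℂ] E) (f : lp (fun _ : ℕ => E) 2) (k : ℕ) :
    amplify E T f k = T (f k) := rfl

theorem amplify_injective (E : Type*) [NormedAddCommGroup E] [InnerProductSpace ℂ E]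
    [CompleteSpace E] : Function.Injective (amplify E) := by
  intro S T h
  ext x
  have h2 : amplify E S (lp.single 2 0 x) 0 = amplify E T (lp.single 2 0 x) 0 := by rw [h]
  simpa [amplify_apply] using h2

theorem commutant_trivial_of_starAlgEquiv {A B C : Type*} [CStarAlgebra A] [Semiring B]
    [StarRing B] [Algebra ℂ B] [Semiring C] [StarRing C] [Algebra ℂ C] (Φ : B ≃⋆ₐ[ℂ] C)
    {π : A →⋆ₐ[ℂ] B} (hπ : ∀ T, (∀ a, T * π a = π a * T) → ∃ c : ℂ, T = c • 1) (T : C)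
    (hT : ∀ a, T * (Φ : B →⋆ₐ[ℂ] C).comp π a = (Φ : B →⋆ₐ[ℂ] C).comp π a * T) :
    ∃ c : ℂ, T = c • 1 := by
  obtain ⟨c, hc⟩ := hπ (Φ.symm T) fun a => EquivLike.injective Φ (by
    rw [map_mul, map_mul, StarAlgEquiv.apply_symm_apply]
    exact hT a)
  refine ⟨c, ?_⟩
  rw [← Φ.apply_symm_apply T, hc, map_smul, map_one]

theorem eq_zero_of_starAlgEquiv_comp {A B C : Type*} [CStarAlgebra A] [Semiring B]
    [StarRing B] [Algebra ℂ B] [Semiring C] [StarRing C] [Algebra ℂ C] (Φ : B ≃⋆ₐ[ℂ] C)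
    {π : A →⋆ₐ[ℂ] B} {a : A} (h : (Φ : B →⋆ₐ[ℂ] C).comp π a = 0) : π a = 0 :=
  EquivLike.injective Φ (h.trans (map_zero Φ).symm)

/-- Amplifying a finite-dimensional irreducible representation gives an element of `Sigma0`. -/
theorem exists_mem_Sigma0_of_finite {A : Type*} [CStarAlgebra A] {n : ℕ} (hn : 0 < n)
    (ρ : A →⋆ₐ[ℂ] (EuclideanSpace ℂ (Fin n) →L[ℂ] EuclideanSpace ℂ (Fin n)))
    (hρ : ∀ T, (∀ a : A, T * ρ a = ρ a * T) → ∃ c : ℂ, T = c • 1) :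
    ∃ π ∈ Sigma0 A, ∀ a, π a = 0 → ρ a = 0 := by
  obtain ⟨u⟩ := nonempty_linearIsometryEquiv_lpE hn
  let M : Matrix (Fin n) (Fin n) ℂ ≃⋆ₐ[ℂ] _ := Matrix.toEuclideanCLM
  let σ : A →⋆ₐ[ℂ] Matrix (Fin n) (Fin n) ℂ := (M.symm : _ →⋆ₐ[ℂ] _).comp ρ
  have hσ := commutant_trivial_of_starAlgEquiv M.symm hρ
  refine ⟨(u.conjStarAlgEquiv : (lpE n →L[ℂ] lpE n) →⋆ₐ[ℂ] BH).comp ((amplify _).comp ρ),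
    Or.inr ⟨n, hn, σ, hσ, u.symm, fun a f k => ?_⟩, fun a ha => ?_⟩
  · change u.symm (u (amplify (EuclideanSpace ℂ (Fin n)) (ρ a) (u.symm (u f)))) k =
      M (M.symm (ρ a)) (f k)
    rw [M.apply_symm_apply, LinearIsometryEquiv.symm_apply_apply,
      LinearIsometryEquiv.symm_apply_apply, amplify_apply]
  · refine amplify_injective _ ?_
    rw [map_zero]
    exact eq_zero_of_starAlgEquiv_comp (π := (amplify _).comp ρ) u.conjStarAlgEquiv ha

theorem exists_mem_Sigma0_of_infinite {A H : Type*} [CStarAlgebra A] [NormedAddCommGroup H]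
    [InnerProductSpace ℂ H] [CompleteSpace H] (e : H ≃ₗᵢ[ℂ] H2) (ρ : A →⋆ₐ[ℂ] (H →L[ℂ] H))
    (hρ : ∀ T, (∀ a : A, T * ρ a = ρ a * T) → ∃ c : ℂ, T = c • 1) :
    ∃ π ∈ Sigma0 A, ∀ a, π a = 0 → ρ a = 0 :=
  ⟨(e.conjStarAlgEquiv : (H →L[ℂ] H) →⋆ₐ[ℂ] BH).comp ρ,
    Or.inl fun T hT => commutant_trivial_of_starAlgEquiv e.conjStarAlgEquiv hρ T hT,
    fun _ ha => eq_zero_of_starAlgEquiv_comp e.conjStarAlgEquiv ha⟩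

theorem exists_mem_Sigma0_apply_ne_zero {A : Type*} [CStarAlgebra A]
    [TopologicalSpace.SeparableSpace A] {b : A} (hb : b ≠ 0) : ∃ π ∈ Sigma0 A, π b ≠ 0 := by
  obtain ⟨H, _, _, _, π, ξ, hπ, hcyc, hcomm⟩ := exists_irreducible_cyclic hb
  have hπc : Continuous π :=
    AddMonoidHomClass.continuous_of_bound π 1 fun a => by
      simpa using NonUnitalStarAlgHom.norm_apply_le π a
  have hcont : Continuous fun a => π a ξ := hπc.clm_apply continuous_const
  have : TopologicalSpace.SeparableSpace H := hcyc.separableSpace hcont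
  obtain ⟨w, B, -⟩ := exists_hilbertBasis ℂ H
  have : Countable w := B.orthonormal.countable_of_separableSpace
  rcases finite_or_infinite w with hw | hw
  · have := Fintype.ofFinite w
    obtain ⟨e⟩ : Nonempty (H ≃ₗᵢ[ℂ] EuclideanSpace ℂ (Fin (Fintype.card w))) :=
      ⟨(B.toOrthonormalBasis.reindex (Fintype.equivFin w)).repr⟩
    have hn : 0 < Fintype.card w := by
      by_contra h0
      have hE : IsEmpty (Fin (Fintype.card w)) := by
        rw [Nat.eq_zero_of_not_pos h0]; infer_instance
      exact hπ (ContinuousLinearMap.ext fun x => e.injective (Subsingleton.elim _ _))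
    let ρ : A →⋆ₐ[ℂ] (EuclideanSpace ℂ (Fin (Fintype.card w)) →L[ℂ]
        EuclideanSpace ℂ (Fin (Fintype.card w))) :=
      (e.conjStarAlgEquiv : (H →L[ℂ] H) →⋆ₐ[ℂ] _).comp π
    have hρ : ∀ T, (∀ a : A, T * ρ a = ρ a * T) → ∃ c : ℂ, T = c • 1 := fun T hT =>
      commutant_trivial_of_starAlgEquiv e.conjStarAlgEquiv hcomm T hT
    obtain ⟨σ, hσ, hσ0⟩ := exists_mem_Sigma0_of_finite hn ρ hρ
    exact ⟨σ, hσ, fun h0 => hπ (eq_zero_of_starAlgEquiv_comp e.conjStarAlgEquiv (hσ0 b h0))⟩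
  · obtain ⟨e⟩ := B.nonempty_linearIsometryEquiv_H2
    obtain ⟨σ, hσ, hσ0⟩ := exists_mem_Sigma0_of_infinite e π hcomm
    exact ⟨σ, hσ, fun h0 => hπ (hσ0 b h0)⟩

theorem norm_repSp_apply_le {A : Type*} [CStarAlgebra A] (π : RepSp A) (a : A) :
    ‖π a‖ ≤ ‖a‖ :=
  NonUnitalStarAlgHom.norm_apply_le π a

theorem norm_sub_le_dRep {A : Type*} [CStarAlgebra A] {K : Set A} (hK : IsCompact K)
    (π₁ π₂ : RepSp A) {a : A} (ha : a ∈ K) : ‖π₁ a - π₂ a‖ ≤ dRep K π₁ π₂ := by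
  obtain ⟨C, hC0, hC⟩ := hK.isBounded.exists_pos_norm_le
  have hbdd : BddAbove (Set.range fun a => ⨆ (_ : a ∈ K), ‖π₁ a - π₂ a‖) := by
    refine ⟨C + C, ?_⟩
    rintro _ ⟨b, rfl⟩
    refine Real.iSup_le (fun hb => ?_) (by positivity)
    exact (norm_sub_le _ _).trans (add_le_add ((norm_repSp_apply_le _ _).trans (hC b hb))
      ((norm_repSp_apply_le _ _).trans (hC b hb)))
  exact le_ciSup_of_le hbdd a (by rw [ciSup_pos ha])

theorem dRep_le {A : Type*} [CStarAlgebra A] {K : Set A} {π₁ π₂ : RepSp A} {r : ℝ} (hr : 0 ≤ r)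
    (h : ∀ a ∈ K, ‖π₁ a - π₂ a‖ ≤ r) : dRep K π₁ π₂ ≤ r :=
  Real.iSup_le (fun a => Real.iSup_le (h a) hr) hr

theorem mem_SigmaSet_of_mem_Sigma0 {A : Type*} [CStarAlgebra A] {K : Set A} {π : RepSp A}
    (hπ : π ∈ Sigma0 A) : π ∈ SigmaSet K := fun _ hε =>
  ⟨π, hπ, (dRep_le le_rfl (by simp)).trans_lt hε⟩

/-- Conjugation of a representation by a unitary. -/
def conjRep {A : Type*} [CStarAlgebra A] (u : H2 ≃ₗᵢ[ℂ] H2) (π : RepSp A) : RepSp A :=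
  (u.conjStarAlgEquiv : BH →⋆ₐ[ℂ] BH).comp π

theorem conjRep_apply {A : Type*} [CStarAlgebra A] (u : H2 ≃ₗᵢ[ℂ] H2) (π : RepSp A) (a : A) :
    conjRep u π a = u.conjStarAlgEquiv (π a) := rfl

theorem conjRep_mem_Sigma0 {A : Type*} [CStarAlgebra A] (u : H2 ≃ₗᵢ[ℂ] H2) {π : RepSp A}
    (hπ : π ∈ Sigma0 A) : conjRep u π ∈ Sigma0 A := by
  rcases hπ with hπ | ⟨n, hn, ρ, hρ, w, hw⟩
  · exact Or.inl fun T hT => commutant_trivial_of_starAlgEquiv u.conjStarAlgEquiv hπ T hT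
  · refine Or.inr ⟨n, hn, ρ, hρ, u.symm.trans w, fun a f k => ?_⟩
    rw [← hw a f k, conjRep_apply]
    simp

/-- There is a unitary fixing `x` and moving `y` to `z`, when the three vectors are orthogonal. -/
theorem exists_linearIsometryEquiv_fix_move {H : Type*} [NormedAddCommGroup H]
    [InnerProductSpace ℂ H] {x y z : H} (hyz : ‖y‖ = ‖z‖) (h : ⟪y, z⟫_ℂ = 0)
    (hxy : ⟪x, y⟫_ℂ = 0) (hxz : ⟪x, z⟫_ℂ = 0) : ∃ u : H ≃ₗᵢ[ℂ] H, u x = x ∧ u y = z := by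
  let R : H ≃ₗᵢ[ℂ] H := (ℂ ∙ (y - z))ᗮ.reflection
  have h' : ⟪z, y⟫_ℂ = 0 := inner_eq_zero_symm.1 h
  have hfix : ∀ v, ⟪y - z, v⟫_ℂ = 0 → R v = v := fun v hv =>
    Submodule.reflection_mem_subspace_eq_self
      (Submodule.mem_orthogonal_singleton_iff_inner_right.2 hv)
  have hneg : R (y - z) = -(y - z) := Submodule.reflection_orthogonalComplement_singleton_eq_neg _
  refine ⟨R, hfix x ?_, ?_⟩
  · rw [inner_sub_left, inner_eq_zero_symm.1 hxy, inner_eq_zero_symm.1 hxz, sub_zero]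
  · have hadd : R (y + z) = y + z := hfix _ (by
      simp only [inner_sub_left, inner_add_right, h, h', inner_self_eq_norm_sq_to_K, hyz]
      simp)
    have hy : y = (1 / 2 : ℂ) • ((y + z) + (y - z)) := by
      module
    rw [hy, map_smul, map_add, hadd, hneg]
    module

theorem not_finiteDimensional_H2 : ¬ FiniteDimensional ℂ H2 := by
  intro h
  let b : HilbertBasis ℕ ℂ H2 := ⟨LinearIsometryEquiv.refl ℂ H2⟩
  have := b.orthonormal.linearIndependent.finite_of_isNoetherian
  exact not_finite ℕ

theorem exists_orthonormal_seq_orthogonal (V : Submodule ℂ H2) [FiniteDimensional ℂ V] :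
    ∃ ζ : ℕ → H2, Orthonormal ℂ ζ ∧ ∀ n, ζ n ∈ Vᗮ := by
  obtain ⟨w, b, -⟩ := exists_hilbertBasis ℂ Vᗮ
  rcases finite_or_infinite w with hw | hw
  · have := Fintype.ofFinite w
    have hS : FiniteDimensional ℂ Vᗮ := b.toOrthonormalBasis.toBasis.finiteDimensional_of_finite
    have htop : V ⊔ Vᗮ = ⊤ := V.sup_orthogonal_of_hasOrthogonalProjection
    have : FiniteDimensional ℂ (V ⊔ Vᗮ : Submodule ℂ H2) := inferInstance
    rw [htop] at this
    exact absurd (Module.Finite.equiv (Submodule.topEquiv (R := ℂ) (M := H2)))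
      not_finiteDimensional_H2
  · let e := Infinite.natEmbedding w
    refine ⟨fun n => (b (e n) : H2), ?_, fun n => (b (e n)).2⟩
    exact (b.orthonormal.comp e e.injective).comp_linearIsometry Vᗮ.subtypeₗᵢ

/-- The unitary orbit of a non-scalar operator contains a uniformly separated sequence. -/
theorem exists_separated_unitary_orbit {T : BH} (hT : ¬ ∃ c : ℂ, T = c • 1) :
    ∃ r > 0, ∃ u : ℕ → H2 ≃ₗᵢ[ℂ] H2, ∀ n m, n ≠ m →
      r ≤ ‖(u n).conjStarAlgEquiv T - (u m).conjStarAlgEquiv T‖ := by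
  obtain ⟨x, hx⟩ : ∃ x, LinearIndependent ℂ ![x, T x] := by
    by_contra! hcon
    obtain ⟨c, hc⟩ := LinearMap.exists_eq_smul_id_of_forall_notLinearIndependent
      (f := (T : H2 →ₗ[ℂ] H2)) hcon
    exact hT ⟨c, ContinuousLinearMap.ext fun v => DFunLike.congr_fun hc v⟩
  rw [LinearIndependent.pair_iff] at hx
  have hx0 : x ≠ 0 := by
    rintro rfl
    simpa using hx 1 0 (by simp)
  let c : ℂ := ⟪x, T x⟫_ℂ / ⟪x, x⟫_ℂ
  let y : H2 := T x - c • x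
  have hy0 : y ≠ 0 := fun h => by
    have := hx (-c) 1 (by rw [← h]; module)
    exact one_ne_zero this.2
  have hxy : ⟪x, y⟫_ℂ = 0 := by
    have : ⟪x, x⟫_ℂ ≠ 0 := inner_self_ne_zero.2 hx0
    simp only [y, c, inner_sub_right, inner_smul_right]
    field_simp
    ring
  have hTx : T x = c • x + y := by simp [y]
  have : FiniteDimensional ℂ (Submodule.span ℂ {x, y}) :=
    FiniteDimensional.span_of_finite ℂ (Set.toFinite _)
  obtain ⟨ζ, hζ, hζV⟩ := exists_orthonormal_seq_orthogonal (Submodule.span ℂ {x, y})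
  have hζx : ∀ n, ⟪x, ζ n⟫_ℂ = 0 := fun n =>
    (Submodule.mem_orthogonal _ _).1 (hζV n) x (Submodule.subset_span (by simp))
  have hζy : ∀ n, ⟪y, ζ n⟫_ℂ = 0 := fun n =>
    (Submodule.mem_orthogonal _ _).1 (hζV n) y (Submodule.subset_span (by simp))
  have hu : ∀ n, ∃ u : H2 ≃ₗᵢ[ℂ] H2, u x = x ∧ u y = (‖y‖ : ℂ) • ζ n := fun n =>
    exists_linearIsometryEquiv_fix_move (by rw [norm_smul, hζ.1 n]; simp)
      (by rw [inner_smul_right, hζy, mul_zero]) hxy (by rw [inner_smul_right, hζx, mul_zero])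
  choose u hux huy using hu
  have hval : ∀ n, (u n).conjStarAlgEquiv T x = c • x + (‖y‖ : ℂ) • ζ n := fun n => by
    have : (u n).symm x = x := (u n).injective (by rw [LinearIsometryEquiv.apply_symm_apply, hux])
    rw [LinearIsometryEquiv.conjStarAlgEquiv_apply_apply, this, hTx, map_add, map_smul, hux, huy]
  have hxpos : 0 < ‖x‖ := norm_pos_iff.2 hx0
  have hypos : 0 < ‖y‖ := norm_pos_iff.2 hy0
  refine ⟨‖y‖ / ‖x‖, by positivity, u, fun n m hnm => ?_⟩
  rw [div_le_iff₀ hxpos]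
  refine le_trans ?_ (ContinuousLinearMap.le_opNorm _ x)
  rw [sub_apply, hval, hval, add_sub_add_left_eq_sub, ← smul_sub, norm_smul]
  simpa using le_mul_of_one_le_right hypos.le (hζ.one_lt_norm_sub hnm).le

/-- If `Σ(A)` is compact, every representation in `Σ⁰(A)` is scalar on the generating set. -/
theorem scalar_of_repSeqCompact {A : Type*} [CStarAlgebra A] {K : Set A} (hK : IsCompact K)
    (hcomp : RepSeqCompact K (SigmaSet K)) {π : RepSp A} (hπ : π ∈ Sigma0 A) {a : A}
    (ha : a ∈ K) : ∃ c : ℂ, π a = c • 1 := by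
  by_contra hcon
  obtain ⟨r, hr, u, hu⟩ := exists_separated_unitary_orbit hcon
  obtain ⟨σ, -, φ, hφ, hlim⟩ := hcomp (fun n => conjRep (u n) π) fun n =>
    mem_SigmaSet_of_mem_Sigma0 (conjRep_mem_Sigma0 (u n) hπ)
  obtain ⟨N, hN⟩ := Filter.eventually_atTop.1 (hlim.eventually_lt_const (half_pos hr))
  have h1 := (norm_sub_le_dRep hK (conjRep (u (φ N)) π) σ ha).trans_lt (hN N le_rfl)
  have h2 := (norm_sub_le_dRep hK (conjRep (u (φ (N + 1))) π) σ ha).trans_lt (hN (N + 1) (by simp))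
  have h3 := hu (φ N) (φ (N + 1)) (hφ.injective.ne (by simp))
  rw [← conjRep_apply, ← conjRep_apply] at h3
  have h4 := norm_sub_le_norm_sub_add_norm_sub (conjRep (u (φ N)) π a) (σ a)
    (conjRep (u (φ (N + 1))) π a)
  rw [norm_sub_rev (σ a)] at h4
  linarith

theorem commute_of_generates {A : Type*} [CStarAlgebra A] {K : Set A} (hgen : Generates K)
    (π : RepSp A) (hπ : ∀ a ∈ K, ∃ c : ℂ, π a = c • 1) (a : A) (T : BH) : π a * T = T * π a := by
  let S : StarSubalgebra ℂ A := (StarSubalgebra.centralizer ℂ (Set.univ : Set BH)).comap π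
  have hmem : ∀ {a : A}, a ∈ S ↔ ∀ T : BH, T * π a = π a * T := by
    intro a
    rw [StarSubalgebra.mem_comap, StarSubalgebra.mem_centralizer_iff]
    exact ⟨fun h T => (h T trivial).1, fun h T _ => ⟨h T, h (star T)⟩⟩
  have hclosed : IsClosed (S : Set A) := by
    have hπc : Continuous π :=
      AddMonoidHomClass.continuous_of_bound π 1 fun a => by
        simpa using norm_repSp_apply_le π a
    have : (S : Set A) = ⋂ T : BH, {a | T * π a = π a * T} := by
      ext a
      simp only [Set.mem_iInter, SetLike.mem_coe, hmem, Set.mem_ofPred_eq]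
    rw [this]
    exact isClosed_iInter fun T =>
      isClosed_eq (continuous_const.mul hπc) (hπc.mul continuous_const)
  have hKS : K ⊆ S := fun b hb => hmem.2 fun T => by
    obtain ⟨c, hc⟩ := hπ b hb
    rw [hc]
    simp
  have htop := StarSubalgebra.topologicalClosure_minimal (StarAlgebra.adjoin_le hKS) hclosed
  rw [hgen] at htop
  exact (hmem.1 (htop trivial) T).symm

theorem mul_comm_of_repSeqCompact {A : Type*} [CStarAlgebra A]
    [TopologicalSpace.SeparableSpace A] {K : Set A} (hK : IsCompact K) (hgen : Generates K)
    (hcomp : RepSeqCompact K (SigmaSet K)) (a b : A) : a * b = b * a := by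
  by_contra hab
  obtain ⟨π, hπ, hne⟩ := exists_mem_Sigma0_apply_ne_zero (sub_ne_zero.2 hab)
  apply hne
  rw [map_sub, map_mul, map_mul, sub_eq_zero]
  exact commute_of_generates hgen π (fun c hc => scalar_of_repSeqCompact hK hcomp hπ hc) a _

/-- The scalar representation on `ℓ²` given by a character. -/
def characterRep {A : Type*} [CStarAlgebra A] (χ : WeakDual.characterSpace ℂ A) : RepSp A :=
  (StarAlgHom.ofId ℂ BH).comp (χ : A →⋆ₐ[ℂ] ℂ)

theorem characterRep_apply {A : Type*} [CStarAlgebra A] (χ : WeakDual.characterSpace ℂ A)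
    (a : A) : characterRep χ a = χ a • 1 :=
  Algebra.algebraMap_eq_smul_one (χ a)

instance : Nontrivial H2 :=
  not_subsingleton_iff_nontrivial.1 fun _ => not_finiteDimensional_H2 inferInstance

theorem norm_characterRep_apply {A : Type*} [CStarAlgebra A] (χ : WeakDual.characterSpace ℂ A)
    (a : A) : ‖characterRep χ a‖ = ‖χ a‖ := by
  rw [characterRep_apply, norm_smul, norm_one, mul_one]

theorem norm_characterRep_sub {A : Type*} [CStarAlgebra A] (χ χ' : WeakDual.characterSpace ℂ A)
    (a : A) : ‖characterRep χ a - characterRep χ' a‖ = ‖χ a - χ' a‖ := by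
  rw [characterRep_apply, characterRep_apply, ← sub_smul, norm_smul, norm_one, mul_one]

theorem characterRep_mem_Sigma0 {A : Type*} [CStarAlgebra A]
    (χ : WeakDual.characterSpace ℂ A) : characterRep χ ∈ Sigma0 A := by
  obtain ⟨u⟩ := nonempty_linearIsometryEquiv_lpE one_pos
  refine Or.inr ⟨1, one_pos, (StarAlgHom.ofId ℂ _).comp (χ : A →⋆ₐ[ℂ] ℂ), fun T _ => ⟨T 0 0, ?_⟩,
    u.symm, fun a f k => ?_⟩
  · ext i j
    rw [Subsingleton.elim i 0, Subsingleton.elim j 0]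
    simp
  · have hρ : (StarAlgHom.ofId ℂ (Matrix (Fin 1) (Fin 1) ℂ)).comp (χ : A →⋆ₐ[ℂ] ℂ) a = χ a • 1 :=
      Algebra.algebraMap_eq_smul_one (χ a)
    rw [hρ, characterRep_apply]
    simp [Matrix.toEuclideanLin]

theorem eventually_dRep_characterRep_lt {A : Type*} [CStarAlgebra A] {K : Set A}
    (hK : IsCompact K) (χ₀ : WeakDual.characterSpace ℂ A) {δ : ℝ} (hδ : 0 < δ) :
    ∀ᶠ χ in nhds χ₀, dRep K (characterRep χ₀) (characterRep χ) < δ := by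
  obtain ⟨t, ht, hKt⟩ := Metric.totallyBounded_iff.1 hK.totallyBounded (δ / 6) (by positivity)
  have hev : ∀ᶠ χ in nhds χ₀, ∀ b ∈ t, ‖χ₀ b - χ b‖ < δ / 6 := by
    refine (Filter.eventually_all_finite ht).2 fun b _ => ?_
    have hcont : Continuous fun χ : WeakDual.characterSpace ℂ A => ‖χ₀ b - χ b‖ :=
      (continuous_const.sub ((WeakDual.eval_continuous b).comp continuous_subtype_val)).norm
    exact hcont.continuousAt.eventually_lt continuousAt_const (by simpa using hδ)
  filter_upwards [hev] with χ hχ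
  refine (dRep_le (r := δ / 2) (by positivity) fun a ha => ?_).trans_lt (half_lt_self hδ)
  obtain ⟨b, hb, hab⟩ := Set.mem_iUnion₂.1 (hKt ha)
  rw [Metric.mem_ball, dist_eq_norm] at hab
  have hb' := hχ b hb
  rw [← norm_characterRep_sub] at hb'
  have h1 := norm_repSp_apply_le (characterRep χ₀) (a - b)
  have h2 := norm_repSp_apply_le (characterRep χ) (a - b)
  calc ‖characterRep χ₀ a - characterRep χ a‖
      = ‖characterRep χ₀ (a - b) + (characterRep χ₀ b - characterRep χ b)
          - characterRep χ (a - b)‖ := by rw [map_sub, map_sub]; congr 1; abel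
    _ ≤ ‖characterRep χ₀ (a - b)‖ + ‖characterRep χ₀ b - characterRep χ b‖
          + ‖characterRep χ (a - b)‖ := (norm_sub_le _ _).trans (by gcongr; exact norm_add_le _ _)
    _ ≤ δ / 2 := by linarith

/-- The strong Ascoli property for commutative C⋆-algebras. -/
theorem isCompact_closure_of_commutative {A : Type*} [CommCStarAlgebra A] {K : Set A}
    (hK : IsCompact K) {L : Set A} (hbdd : ∃ C : ℝ, ∀ x ∈ L, ‖x‖ ≤ C)
    (hequi : ∀ ε > (0 : ℝ), ∃ δ > (0 : ℝ),
      ∀ π ∈ SigmaSet (A := A) K, ∀ π' ∈ SigmaSet (A := A) K,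
        dRep K π π' < δ → ∀ x ∈ L, ‖π x - π' x‖ < ε) :
    IsCompact (closure L) := by
  obtain ⟨C, hC⟩ := hbdd
  let F : A → BoundedContinuousFunction (WeakDual.characterSpace ℂ A) ℂ := fun a =>
    BoundedContinuousFunction.mkOfCompact (WeakDual.gelfandTransform ℂ A a)
  have hF : Isometry F :=
    (ContinuousMap.isometryEquivBoundedOfCompact _ _).isometry.comp (gelfandTransform_isometry A)
  have hcomp : IsCompact (closure (F '' L)) := by
    refine BoundedContinuousFunction.arzela_ascoli (Metric.closedBall 0 C)
      (isCompact_closedBall 0 C) _ ?_ ?_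
    · rintro _ χ ⟨x, hx, rfl⟩
      rw [mem_closedBall_zero_iff]
      exact (norm_characterRep_apply χ x).symm.trans_le
        ((norm_repSp_apply_le _ x).trans (hC x hx))
    · intro χ₀
      rw [Metric.equicontinuousAt_iff_right]
      intro ε hε
      obtain ⟨δ, hδ, h⟩ := hequi ε hε
      filter_upwards [eventually_dRep_characterRep_lt hK χ₀ hδ] with χ hχ
      rintro ⟨_, x, hx, rfl⟩
      rw [dist_eq_norm]
      have := h _ (mem_SigmaSet_of_mem_Sigma0 (characterRep_mem_Sigma0 χ₀)) _
        (mem_SigmaSet_of_mem_Sigma0 (characterRep_mem_Sigma0 χ)) hχ x hx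
      rwa [norm_characterRep_sub] at this
  refine (hF.isClosedEmbedding.isCompact_preimage hcomp).of_isClosed_subset isClosed_closure ?_
  exact closure_minimal (fun x hx => subset_closure ⟨x, hx, rfl⟩)
    (isClosed_closure.preimage hF.continuous)

end Helpers

theorem stmt17 (A : Type*) [CStarAlgebra A] [TopologicalSpace.SeparableSpace A]
    (K : Set A) (hK : IsCompact K) (hgen : Generates K)
    (hcomp : RepSeqCompact K (SigmaSet K))
    (L : Set A)
    (hbdd : ∃ C : ℝ, ∀ x ∈ L, ‖x‖ ≤ C)
    (hequi : ∀ ε > (0 : ℝ), ∃ δ > (0 : ℝ),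
      ∀ π ∈ SigmaSet (A := A) K, ∀ π' ∈ SigmaSet (A := A) K,
        dRep K π π' < δ → ∀ x ∈ L, ‖π x - π' x‖ < ε) :
    IsCompact (closure L) := by
  have hmul : ∀ a b : A, a * b = b * a := mul_comm_of_repSeqCompact hK hgen hcomp
  let : CommCStarAlgebra A := { ‹CStarAlgebra A› with mul_comm := hmul }
  exact isCompact_closure_of_commutative hK hbdd hequi
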